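/- The monoid free product M₁ ∗ M₂ of two monoids is automatic if and only if both M₁ and M₂ are automatic. -/

import Mathlib

namespace AutoSg

/-- Evaluation of a nonempty word over alphabet `A` in a semigroup `S`
via the letter-interpretation map `ψ`; the empty word evaluates to `none`. -/
def evalWord {S : Type*} [Semigroup S] {A : Type*} (ψ : A → S) : List A → Option S
  | [] => none
  | a :: w => some ((w.map ψ).foldl (· * ·) (ψ a))

/-- The standard padding map `δ_A` on pairs of words, with `none` playing
the role of the padding symbol `$`. -/
def padMap {A : Type*} (u v : List A) : List (Option A × Option A) :=
  List.zipWith Prod.mk (u.map some ++ List.replicate (v.length - u.length) none)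
    (v.map some ++ List.replicate (u.length - v.length) none)

/-- `(A, L)` is an automatic structure for the semigroup `S` with respect to `ψ`. -/
structure IsAutomaticStructure (S : Type*) [Semigroup S] {A : Type*} [Finite A]
    (ψ : A → S) (L : Language A) : Prop where
  nonempty_words : ∀ w ∈ L, w ≠ []
  regular : L.IsRegular
  onto : ∀ s : S, ∃ w ∈ L, evalWord ψ w = some s
  eq_regular : Language.IsRegular
    {p : List (Option A × Option A) |
      ∃ u ∈ L, ∃ v ∈ L, p = padMap u v ∧ evalWord ψ u = evalWord ψ v}
  mul_regular : ∀ a : A, Language.IsRegular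
    {p : List (Option A × Option A) |
      ∃ u ∈ L, ∃ v ∈ L, p = padMap u v ∧ evalWord ψ (u ++ [a]) = evalWord ψ v}

/-- An automatic structure with uniqueness: each element of `S` is represented
by exactly one word of `L`. -/
structure IsAutomaticStructureWithUniqueness (S : Type*) [Semigroup S] {A : Type*} [Finite A]
    (ψ : A → S) (L : Language A) extends IsAutomaticStructure S ψ L : Prop where
  unique : ∀ u ∈ L, ∀ v ∈ L, evalWord ψ u = evalWord ψ v → u = v

/-- A semigroup is automatic if it admits an automatic structure. -/
def IsAutomaticSemigroup (S : Type*) [Semigroup S] : Prop :=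
  ∃ (A : Type) (_ : Finite A) (ψ : A → S) (L : Language A), IsAutomaticStructure S ψ L

end AutoSg

namespace AutoSg

section RegularLanguages

variable {α β σ : Type*}

/-- A language is regular when its left quotients are unions of members of a finite family. -/
theorem isRegular_of_finite_cover {K : Language α} {F : Set (Language α)} (hF : F.Finite)
    (h : ∀ x y, x ++ y ∈ K → ∃ l ∈ F, y ∈ l ∧ ∀ z ∈ l, x ++ z ∈ K) : K.IsRegular := by
  apply Language.IsRegular.of_finite_range_leftQuotient
  refine (hF.powerset.image fun S => ({y | ∃ l ∈ S, y ∈ l} : Language α)).subset ?_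
  rintro _ ⟨x, rfl⟩
  refine ⟨{l ∈ F | ∀ z ∈ l, x ++ z ∈ K}, fun l hl => hl.1, ?_⟩
  ext y
  constructor
  · rintro ⟨l, hl, hy⟩
    exact hl.2 y hy
  · intro hy
    obtain ⟨l, hl, hyl, hz⟩ := h x y hy
    exact ⟨l, ⟨hl, hz⟩, hyl⟩

/-- The language of all words whose letters satisfy `P`. -/
def wordsOver (P : α → Prop) : Language α := {x | ∀ a ∈ x, P a}

theorem isRegular_wordsOver (P : α → Prop) : (wordsOver P).IsRegular := by
  refine isRegular_of_finite_cover (Set.finite_singleton (wordsOver P))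
    fun x y hxy => ⟨_, rfl, ?_, ?_⟩
  · exact fun a ha => hxy a (List.mem_append_right _ ha)
  · intro z hz a ha
    rcases List.mem_append.1 ha with ha | ha
    · exact hxy a (List.mem_append_left _ ha)
    · exact hz a ha

theorem _root_.Language.IsRegular.congr {K L : Language α} (hK : K.IsRegular)
    (h : ∀ x, x ∈ L ↔ x ∈ K) : L.IsRegular := by
  rwa [Language.ext h]

theorem isRegular_singleton (w : List α) : Language.IsRegular ({w} : Language α) := by
  refine isRegular_of_finite_cover (F := (fun y => ({y} : Language α)) '' {y | y ∈ w.tails})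
    (w.tails.finite_toSet.image _) fun x y hxy => ⟨{y}, ⟨y, ?_, rfl⟩, rfl, ?_⟩
  · exact (List.mem_tails _ _).2 ⟨x, hxy⟩
  · rintro z rfl
    exact hxy

theorem isRegular_foldl {σ : Type} [Finite σ] (f : σ → α → σ) (s : σ) (S : Set σ) :
    Language.IsRegular ({x | x.foldl f s ∈ S} : Language α) := by
  have := Fintype.ofFinite σ
  exact ⟨σ, inferInstance, ⟨f, s, S⟩, rfl⟩

theorem _root_.Language.IsRegular.flatMap {K : Language β} (hK : K.IsRegular) (f : α → List β) :
    Language.IsRegular ({x | x.flatMap f ∈ K} : Language α) := by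
  refine isRegular_of_finite_cover
    (hK.finite_range_leftQuotient.image fun l => ({y | y.flatMap f ∈ l} : Language α)) ?_
  intro x y hxy
  refine ⟨_, ⟨_, ⟨x.flatMap f, rfl⟩, rfl⟩, ?_, ?_⟩
  · change x.flatMap f ++ y.flatMap f ∈ K
    rw [← List.flatMap_append]; exact hxy
  · intro z hz
    change (x ++ z).flatMap f ∈ K
    rw [List.flatMap_append]; exact hz

theorem _root_.Language.IsRegular.comap {K : Language β} (hK : K.IsRegular) (f : α → β) :
    Language.IsRegular ({x | x.map f ∈ K} : Language α) := by
  have := hK.flatMap fun a => [f a]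
  simpa only [← List.map_eq_flatMap] using this

theorem _root_.Language.IsRegular.map {K : Language α} (hK : K.IsRegular) (f : α → β) :
    (Language.map f K).IsRegular := by
  refine isRegular_of_finite_cover
    (hK.finite_range_leftQuotient.image fun l => Language.map f l) ?_
  rintro x y ⟨w, hw, hxy⟩
  obtain ⟨x, y, rfl, rfl, rfl⟩ := List.map_eq_append_iff.1 hxy
  refine ⟨_, ⟨_, ⟨x, rfl⟩, rfl⟩, ⟨y, hw, rfl⟩, ?_⟩
  rintro _ ⟨z, hz, rfl⟩
  exact ⟨x ++ z, hz, List.map_append⟩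

theorem _root_.Language.IsRegular.strip {K : Language α} (hK : K.IsRegular) (c : α) :
    Language.IsRegular ({x | ∃ k, x ++ List.replicate k c ∈ K} : Language α) := by
  refine isRegular_of_finite_cover (hK.finite_range_leftQuotient.image
    fun l => ({x | ∃ k, x ++ List.replicate k c ∈ l} : Language α)) ?_
  rintro x y ⟨k, hk⟩
  refine ⟨_, ⟨_, ⟨x, rfl⟩, rfl⟩, ⟨k, ?_⟩, ?_⟩
  · rw [List.append_assoc] at hk; exact hk
  · rintro z ⟨m, hm⟩
    exact ⟨m, by rw [List.append_assoc]; exact hm⟩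

theorem _root_.Language.IsRegular.mul {K L : Language α} (hK : K.IsRegular) (hL : L.IsRegular) :
    (K * L).IsRegular := by
  refine isRegular_of_finite_cover
    ((hK.finite_range_leftQuotient.image fun l => l * L).union hL.finite_range_leftQuotient) ?_
  rintro x y ⟨a, ha, b, hb, hab⟩
  rcases List.append_eq_append_iff.1 hab with ⟨c, rfl, rfl⟩ | ⟨c, rfl, rfl⟩
  · refine ⟨_, Or.inr ⟨c, rfl⟩, hb, fun z hz => ?_⟩
    rw [List.append_assoc]
    exact Language.append_mem_mul ha hz
  · refine ⟨_, Or.inl ⟨_, ⟨x, rfl⟩, rfl⟩, Language.append_mem_mul ha hb, ?_⟩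
    rintro _ ⟨p, hp, q, hq, rfl⟩
    change x ++ (p ++ q) ∈ _
    rw [← List.append_assoc]
    exact Language.append_mem_mul hp hq

open Computability in
theorem append_mem_kstar {K : Language α} {x y : List α} (hx : x ∈ K∗) (hy : y ∈ K∗) :
    x ++ y ∈ K∗ := by
  obtain ⟨l, rfl, hl⟩ := hx
  obtain ⟨m, rfl, hm⟩ := hy
  refine ⟨l ++ m, by simp, fun z hz => ?_⟩
  rcases List.mem_append.1 hz with h | h
  exacts [hl z h, hm z h]

open Computability in
theorem append_mem_kstar_split {K : Language α} {x y : List α} (h : x ++ y ∈ K∗) :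
    (x ∈ K∗ ∧ y ∈ K∗) ∨ ∃ x₁ x₂ y₁ y₂, x = x₁ ++ x₂ ∧ y = y₁ ++ y₂ ∧
      x₁ ∈ K∗ ∧ x₂ ++ y₁ ∈ K ∧ y₂ ∈ K∗ := by
  obtain ⟨l, hl, hlK⟩ := h
  induction l generalizing x with
  | nil =>
    obtain ⟨rfl, rfl⟩ : x = [] ∧ y = [] := by simpa using hl
    exact Or.inl ⟨Language.nil_mem_kstar _, Language.nil_mem_kstar _⟩
  | cons w l ih =>
    rw [List.flatten_cons] at hl
    have hw := hlK w List.mem_cons_self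
    have hl' : ∀ z ∈ l, z ∈ K := fun z hz => hlK z (List.mem_cons_of_mem _ hz)
    have hwK : w ∈ K∗ := ⟨[w], by simp, by simpa using hw⟩
    rcases List.append_eq_append_iff.1 hl with ⟨c, rfl, rfl⟩ | ⟨c, rfl, hc⟩
    · exact Or.inr ⟨[], x, c, _, rfl, rfl, Language.nil_mem_kstar _, hw, ⟨l, rfl, hl'⟩⟩
    · rcases ih hc.symm hl' with ⟨h1, h2⟩ | ⟨x₁, x₂, y₁, y₂, rfl, rfl, h1, h2, h3⟩
      · exact Or.inl ⟨append_mem_kstar hwK h1, h2⟩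
      · exact Or.inr ⟨w ++ x₁, x₂, y₁, y₂, by simp, rfl, append_mem_kstar hwK h1, h2, h3⟩

open Computability in
theorem _root_.Language.IsRegular.kstar {K : Language α} (hK : K.IsRegular) :
    (K∗).IsRegular := by
  refine isRegular_of_finite_cover
    ((hK.finite_range_leftQuotient.image fun l => l * K∗).union (Set.finite_singleton K∗)) ?_
  intro x y h
  rcases append_mem_kstar_split h with ⟨hx, hy⟩ | ⟨x₁, x₂, y₁, y₂, rfl, rfl, h1, h2, h3⟩
  · exact ⟨_, Or.inr rfl, hy, fun z hz => append_mem_kstar hx hz⟩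
  · refine ⟨_, Or.inl ⟨_, ⟨x₂, rfl⟩, rfl⟩, Language.append_mem_mul h2 h3, ?_⟩
    rintro _ ⟨p, hp, q, hq, rfl⟩
    have hp' : x₂ ++ p ∈ K∗ := ⟨[x₂ ++ p], by simp, List.forall_mem_singleton.2 hp⟩
    have := append_mem_kstar h1 (append_mem_kstar hp' hq)
    simpa using this

end RegularLanguages

section Synchronous

variable {A : Type*} {ι κ : Type*}

/-- The first `n` columns of a tuple of words, padded with `none`. -/
def columns (n : ℕ) (w : ι → List A) : List (ι → Option A) :=
  (List.range n).map fun k i => (w i)[k]?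

@[simp]
theorem length_columns (n : ℕ) (w : ι → List A) : (columns n w).length = n := by
  simp [columns]

@[simp]
theorem getElem_columns (n : ℕ) (w : ι → List A) (j : ℕ) (h : j < (columns n w).length) :
    (columns n w)[j] = fun i => (w i)[j]? := by
  simp [columns]

theorem columns_zero (w : ι → List A) : columns 0 w = [] := rfl

theorem columns_succ (n : ℕ) (w : ι → List A) :
    columns (n + 1) w = (fun i => (w i).head?) :: columns n fun i => (w i).tail := by
  simp only [columns, List.range_succ_eq_map, List.map_cons, List.map_map]
  congr 1
  · funext i
    rw [List.head?_eq_getElem?]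
  · apply List.map_congr_left
    intro k _
    funext i
    simp

theorem columns_map (n : ℕ) (w : ι → List A) (f : κ → ι) :
    (columns n w).map (· ∘ f) = columns n (w ∘ f) := by
  simp [columns, Function.comp_def]

theorem columns_flatMap_toList (n : ℕ) (w : ι → List A) (i : ι) (h : (w i).length ≤ n) :
    (columns n w).flatMap (fun c => (c i).toList) = w i := by
  induction n generalizing w with
  | zero => simp [columns_zero, List.length_eq_zero_iff.1 (Nat.le_zero.1 h)]
  | succ n ih =>
    rw [columns_succ, List.flatMap_cons, ih _ (by simp; omega)]
    cases h : w i <;> simp [h]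

theorem columns_eq_append (n k : ℕ) (w : ι → List A) (h : ∀ i, (w i).length ≤ n) :
    columns (n + k) w = columns n w ++ List.replicate k fun _ => none := by
  induction n generalizing w with
  | zero =>
    simp only [columns, Nat.zero_add, List.range_zero, List.map_nil, List.nil_append]
    refine List.eq_replicate_iff.2 ⟨by simp, ?_⟩
    simp only [List.mem_map]
    rintro _ ⟨j, -, rfl⟩
    ext1 i
    simp [List.length_eq_zero_iff.1 (Nat.le_zero.1 (h i))]
  | succ n ih =>
    rw [Nat.succ_add, columns_succ, columns_succ, ih _ (fun i => by simpa using h i),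
      List.cons_append]

/-- A relation on tuples of words that is recognised by a finite automaton reading all the words
synchronously, irrespective of the amount of padding. -/
def IsSynchronous (R : (ι → List A) → Prop) : Prop :=
  ∃ K : Language (ι → Option A), K.IsRegular ∧
    ∀ (w : ι → List A) (n : ℕ), (∀ i, (w i).length ≤ n) → (columns n w ∈ K ↔ R w)

namespace IsSynchronous

theorem congr {R S : (ι → List A) → Prop} (hR : IsSynchronous R) (h : ∀ w, S w ↔ R w) :
    IsSynchronous S := by
  rwa [show S = R from funext fun w => propext (h w)]

theorem not {R : (ι → List A) → Prop} (hR : IsSynchronous R) : IsSynchronous fun w => ¬ R w := by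
  obtain ⟨K, hK, h⟩ := hR
  exact ⟨Kᶜ, hK.compl, fun w n hn => not_congr (h w n hn)⟩

theorem and {R S : (ι → List A) → Prop} (hR : IsSynchronous R) (hS : IsSynchronous S) :
    IsSynchronous fun w => R w ∧ S w := by
  obtain ⟨K, hK, h⟩ := hR
  obtain ⟨K', hK', h'⟩ := hS
  exact ⟨K ⊓ K', hK.inf hK', fun w n hn => and_congr (h w n hn) (h' w n hn)⟩

theorem or {R S : (ι → List A) → Prop} (hR : IsSynchronous R) (hS : IsSynchronous S) :
    IsSynchronous fun w => R w ∨ S w :=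
  (hR.not.and hS.not).not.congr fun w => by tauto

theorem comap {R : (κ → List A) → Prop} (hR : IsSynchronous R) (f : κ → ι) :
    IsSynchronous fun w : ι → List A => R (w ∘ f) := by
  obtain ⟨K, hK, h⟩ := hR
  refine ⟨_, hK.comap fun c : ι → Option A => c ∘ f, fun w n hn => ?_⟩
  exact (columns_map n w f ▸ Iff.rfl : _ ↔ columns n (w ∘ f) ∈ K).trans (h _ n fun i => hn _)

theorem of_isRegular {L : Language A} (hL : L.IsRegular) (i : ι) :
    IsSynchronous fun w : ι → List A => w i ∈ L := by
  refine ⟨_, hL.flatMap fun c : ι → Option A => (c i).toList, fun w n hn => ?_⟩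
  change (columns n w).flatMap _ ∈ L ↔ _
  rw [columns_flatMap_toList n w i (hn i)]

theorem eq (i j : ι) : IsSynchronous fun w : ι → List A => w i = w j := by
  refine ⟨_, isRegular_wordsOver fun c => c i = c j, fun w n hn => ?_⟩
  change (∀ c ∈ columns n w, c i = c j) ↔ _
  simp only [columns, List.mem_map, List.mem_range, forall_exists_index, and_imp,
    forall_apply_eq_imp_iff₂]
  refine ⟨fun h => List.ext_getElem? fun k => ?_, fun h k _ => by rw [h]⟩
  by_cases hk : k < n
  · exact h k hk
  · rw [List.getElem?_eq_none ((hn i).trans (not_lt.1 hk)),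
      List.getElem?_eq_none ((hn j).trans (not_lt.1 hk))]

theorem exists_word {R : (Option ι → List A) → Prop} (hR : IsSynchronous R) :
    IsSynchronous fun w : ι → List A => ∃ t, R fun o => o.elim t w := by
  obtain ⟨K, hK, h⟩ := hR
  have hV : (Language.map some (wordsOver fun _ : A => True) * wordsOver (· = none)).IsRegular :=
    ((isRegular_wordsOver _).map _).mul (isRegular_wordsOver _)
  refine ⟨_, ((hK.inf (hV.comap fun c => c none)).map fun c => c ∘ some).strip fun _ => none,
    fun w n hn => ⟨?_, ?_⟩⟩
  · rintro ⟨k, y, ⟨hyK, _, ⟨t, -, rfl⟩, q, hq, hpq⟩, hy⟩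
    replace hpq : t.map some ++ q = y.map fun c => c none := hpq
    replace hy : (y.map fun c => c ∘ some) = columns (n + k) w := by
      rw [columns_eq_append n k w hn, hy]
    have hlen : y.length = n + k := by simpa [columns] using congrArg List.length hy
    have hlen' : t.length + q.length = y.length := by simpa using congrArg List.length hpq
    refine ⟨t, (h _ (n + k) ?_).1 ?_⟩
    · rintro (_ | i)
      · change t.length ≤ _
        omega
      · exact (hn i).trans (Nat.le_add_right _ _)
    · suffices he : columns (n + k) (fun o : Option ι => o.elim t w) = y from he ▸ hyK
      refine List.ext_getElem (by simp [hlen]) fun j h₁ h₂ => ?_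
      funext o
      rcases o with _ | i
      · have hj : (t.map some ++ q)[j]? = (y.map fun c => c none)[j]? := by rw [hpq]
        rw [List.getElem?_map, List.getElem?_eq_getElem h₂, List.getElem?_append] at hj
        rw [getElem_columns]
        change t[j]? = _
        split_ifs at hj with hjt
        · rw [List.length_map] at hjt
          simpa [hjt] using hj
        · rw [List.getElem?_eq_none (by simpa using hjt)]
          exact (hq _ (List.mem_of_getElem? hj)).symm
      · have hj : (y.map fun c => c ∘ some)[j]? = (columns (n + k) w)[j]? := by rw [hy]
        rw [List.getElem?_map, List.getElem?_eq_getElem h₂] at hj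
        rw [List.getElem?_eq_getElem (by simpa [hlen] using h₂), getElem_columns] at hj
        rw [getElem_columns]
        exact (congrFun (Option.some.inj hj) i).symm
  · rintro ⟨t, ht⟩
    have hlen : ∀ o : Option ι, (o.elim t w : List A).length ≤ n + t.length := by
      rintro (_ | i)
      · exact Nat.le_add_left _ _
      · exact (hn i).trans (Nat.le_add_right _ _)
    refine ⟨t.length, _, ⟨(h _ _ hlen).2 ht, t.map some, ⟨t, fun _ _ => trivial, rfl⟩,
      List.replicate n none, fun a ha => List.eq_of_mem_replicate ha, ?_⟩, ?_⟩
    · refine List.ext_getElem (by simp [add_comm]) fun j h₁ h₂ => ?_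
      simp only [List.getElem_map, getElem_columns, List.getElem_append,
        List.length_map, Option.elim_none, List.getElem_replicate]
      split_ifs with hj
      · rw [List.getElem?_eq_getElem hj]
      · rw [List.getElem?_eq_none (not_lt.1 hj)]
    · rw [← columns_eq_append n _ w hn]
      exact columns_map _ _ some

end IsSynchronous

end Synchronous

section Binary

variable {A B : Type*}

theorem padMap_cons_cons (a b : A) (u v : List A) :
    padMap (a :: u) (b :: v) = (some a, some b) :: padMap u v := by
  simp [padMap]

theorem padMap_nil_left (v : List A) : padMap [] v = v.map fun a => (none, some a) := by
  induction v with
  | nil => rfl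
  | cons a v ih => simpa [padMap, List.replicate_succ] using ih

theorem padMap_nil_right (u : List A) : padMap u [] = u.map fun a => (some a, none) := by
  induction u with
  | nil => rfl
  | cons a v ih => simpa [padMap, List.replicate_succ] using ih

theorem padMap_append_left (x u v : List A) :
    padMap (x ++ u) (x ++ v) = (x.map fun a => (some a, some a)) ++ padMap u v := by
  induction x with
  | nil => rfl
  | cons a x ih => rw [List.cons_append, List.cons_append, padMap_cons_cons, ih]; rfl

theorem padMap_map (f : A → B) (u v : List A) :
    padMap (u.map f) (v.map f) = (padMap u v).map (Prod.map (Option.map f) (Option.map f)) := by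
  induction u generalizing v with
  | nil => simp [padMap_nil_left]
  | cons a u ih =>
    cases v with
    | nil => simp [padMap_nil_right]
    | cons b v => simp [padMap_cons_cons, ih]

theorem padMap_mem (u v : List A) : padMap u v ∈
    wordsOver (fun c : Option A × Option A => c.1.isSome ∧ c.2.isSome) *
      (wordsOver (fun c => c.1.isSome ∧ c.2 = none) +
        wordsOver (fun c => c.1 = none ∧ c.2.isSome)) := by
  induction u generalizing v with
  | nil =>
    refine ⟨[], by simp [wordsOver], padMap [] v, Or.inr ?_, rfl⟩
    rw [padMap_nil_left]
    intro c hc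
    obtain ⟨a, -, rfl⟩ := List.mem_map.1 hc
    exact ⟨rfl, rfl⟩
  | cons a u ih =>
    cases v with
    | nil =>
      refine ⟨[], by simp [wordsOver], padMap (a :: u) [], Or.inl ?_, rfl⟩
      rw [padMap_nil_right]
      intro c hc
      obtain ⟨a, -, rfl⟩ := List.mem_map.1 hc
      exact ⟨rfl, rfl⟩
    | cons b v =>
      obtain ⟨x, hx, y, hy, hxy⟩ := ih v
      refine ⟨(some a, some b) :: x, ?_, y, hy, ?_⟩
      · exact List.forall_mem_cons.2 ⟨⟨rfl, rfl⟩, hx⟩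
      · rw [padMap_cons_cons, ← hxy]
        rfl

theorem exists_eq_padMap {x : List (Option A × Option A)} (hx : x ∈
    wordsOver (fun c : Option A × Option A => c.1.isSome ∧ c.2.isSome) *
      (wordsOver (fun c => c.1.isSome ∧ c.2 = none) +
        wordsOver (fun c => c.1 = none ∧ c.2.isSome))) :
    ∃ u v, x = padMap u v := by
  obtain ⟨x, hx, y, hy, rfl⟩ := hx
  induction x with
  | nil =>
    rcases hy with hy | hy
    · have : ∃ u : List A, u.map (fun a => (some a, none)) = y :=
        Set.mem_range.1 ((Set.range_list_map _).symm ▸ fun c hc => by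
          obtain ⟨h1, h2⟩ := hy c hc
          obtain ⟨a, ha⟩ := Option.isSome_iff_exists.1 h1
          exact ⟨a, Prod.ext ha.symm h2.symm⟩)
      obtain ⟨u, rfl⟩ := this
      exact ⟨u, [], (padMap_nil_right u).symm⟩
    · have : ∃ u : List A, u.map (fun a => (none, some a)) = y :=
        Set.mem_range.1 ((Set.range_list_map _).symm ▸ fun c hc => by
          obtain ⟨h1, h2⟩ := hy c hc
          obtain ⟨a, ha⟩ := Option.isSome_iff_exists.1 h2
          exact ⟨a, Prod.ext h1.symm ha.symm⟩)
      obtain ⟨v, rfl⟩ := this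
      exact ⟨[], v, (padMap_nil_left v).symm⟩
  | cons c x ih =>
    obtain ⟨⟨h1, h2⟩, hx⟩ := List.forall_mem_cons.1 hx
    obtain ⟨u, v, h⟩ := ih hx
    obtain ⟨a, ha⟩ := Option.isSome_iff_exists.1 h1
    obtain ⟨b, hb⟩ := Option.isSome_iff_exists.1 h2
    refine ⟨a :: u, b :: v, ?_⟩
    rw [padMap_cons_cons, ← h, ← ha, ← hb]
    rfl

/-- The two-tape column with the given entries. -/
def boolColumn (c : Option A × Option A) : Bool → Option A := fun b => cond b c.2 c.1

theorem map_boolColumn_padMap (u v : List A) : (padMap u v).map boolColumn =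
    columns (max u.length v.length) fun b => cond b v u := by
  induction u generalizing v with
  | nil =>
    rw [padMap_nil_left, List.length_nil, Nat.zero_max]
    refine List.ext_getElem (by simp) fun j h₁ h₂ => ?_
    rw [length_columns] at h₂
    funext b
    cases b <;> simp [boolColumn, h₂]
  | cons a u ih =>
    cases v with
    | nil =>
      rw [padMap_nil_right, List.length_nil, Nat.max_zero]
      refine List.ext_getElem (by simp) fun j h₁ h₂ => ?_
      rw [length_columns] at h₂
      funext b
      cases b
      · rw [List.getElem_map, List.getElem_map, getElem_columns]
        exact (List.getElem?_eq_getElem h₂).symm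
      · rw [List.getElem_map, List.getElem_map, getElem_columns]
        rfl
    | cons b v =>
      rw [List.length_cons, List.length_cons, Nat.succ_max_succ, columns_succ,
        padMap_cons_cons, List.map_cons, ih]
      congr 1
      · funext i
        cases i <;> rfl
      · congr 1
        funext i
        cases i <;> rfl

theorem isSome_of_mem_padMap {u v : List A} {c : Option A × Option A} (hc : c ∈ padMap u v) :
    c.1.isSome ∨ c.2.isSome := by
  obtain ⟨x, hx, y, hy, h⟩ := padMap_mem u v
  rw [← h] at hc
  rcases List.mem_append.1 hc with hc | hc
  · exact Or.inl (hx c hc).1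
  · rcases hy with hy | hy
    · exact Or.inl (hy c hc).1
    · exact Or.inr (hy c hc).2

/-- A binary relation on words recognised by a synchronous finite automaton. -/
def IsSynchronous₂ (R : List A → List A → Prop) : Prop :=
  IsSynchronous fun w : Bool → List A => R (w false) (w true)

open Classical in
theorem flatMap_columns (w : Bool → List A) (n : ℕ) (hn : ∀ i, (w i).length ≤ n) :
    ((columns n w).flatMap fun c => if c = fun _ => none then [] else [(c false, c true)]) =
      padMap (w false) (w true) := by
  have hw : w = fun b => cond b (w true) (w false) := by funext b; cases b <;> rfl
  have hle : max (w false).length (w true).length ≤ n := max_le (hn _) (hn _)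
  have hcol : columns n w = (padMap (w false) (w true)).map boolColumn ++
      List.replicate (n - max (w false).length (w true).length) fun _ => none := by
    rw [map_boolColumn_padMap, ← hw, ← columns_eq_append, Nat.add_sub_cancel' hle]
    rintro (_ | _)
    exacts [le_max_left _ _, le_max_right _ _]
  rw [hcol, List.flatMap_append, List.flatMap_map]
  convert List.append_nil _ using 2
  · simp [List.flatMap_eq_nil_iff]
  · refine Eq.trans (List.map_id _).symm (Eq.trans List.map_eq_flatMap ?_)
    refine List.flatMap_congr fun c hc => ?_
    rw [if_neg]
    · rfl
    · intro h
      have h₁ : c.1 = none := congrFun h false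
      have h₂ : c.2 = none := congrFun h true
      simpa [h₁, h₂] using isSome_of_mem_padMap hc

theorem isSynchronous₂_of_isRegular {R : List A → List A → Prop} {K : Language _}
    (hK : K.IsRegular) (h : ∀ u v, padMap u v ∈ K ↔ R u v) : IsSynchronous₂ R := by
  classical
  refine ⟨_, hK.flatMap fun c : Bool → Option A =>
    if c = fun _ => none then [] else [(c false, c true)], fun w n hn => ?_⟩
  have := h (w false) (w true)
  rw [← flatMap_columns w n hn] at this
  exact this

theorem reduceOption_padMap (u v : List A) :
    ((padMap u v).map Prod.fst).reduceOption = u ∧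
      ((padMap u v).map Prod.snd).reduceOption = v := by
  induction u generalizing v with
  | nil => simp [padMap_nil_left, List.reduceOption]
  | cons a u ih =>
    cases v with
    | nil => simp [padMap_nil_right, List.reduceOption]
    | cons b v => simp [padMap_cons_cons, ih]

theorem padMap_injective {u v u' v' : List A} (h : padMap u v = padMap u' v') :
    u = u' ∧ v = v' := by
  constructor
  · rw [← (reduceOption_padMap u v).1, h, (reduceOption_padMap u' v').1]
  · rw [← (reduceOption_padMap u v).2, h, (reduceOption_padMap u' v').2]

theorem IsSynchronous₂.isRegular {R : List A → List A → Prop} (hR : IsSynchronous₂ R) :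
    Language.IsRegular {p | ∃ u v, p = padMap u v ∧ R u v} := by
  obtain ⟨K, hK, h⟩ := hR
  have key (u v : List A) : (padMap u v).map boolColumn ∈ K ↔ R u v := by
    have := h (fun b => cond b v u) (max u.length v.length) (by
      rintro (_ | _)
      exacts [le_max_left _ _, le_max_right _ _])
    rwa [map_boolColumn_padMap]
  have hV := ((isRegular_wordsOver fun c : Option A × Option A => c.1.isSome ∧ c.2.isSome).mul
    ((isRegular_wordsOver fun c => c.1.isSome ∧ c.2 = none).add
      (isRegular_wordsOver fun c => c.1 = none ∧ c.2.isSome))).inf (hK.comap boolColumn)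
  refine hV.congr fun p => ⟨?_, ?_⟩
  · rintro ⟨u, v, rfl, huv⟩
    exact ⟨padMap_mem u v, (key u v).2 huv⟩
  · rintro ⟨hp, hpK⟩
    obtain ⟨u, v, rfl⟩ := exists_eq_padMap hp
    exact ⟨u, v, rfl, (key u v).1 hpK⟩

theorem isSynchronous₂_iff {R : List A → List A → Prop} :
    IsSynchronous₂ R ↔ Language.IsRegular {p | ∃ u v, p = padMap u v ∧ R u v} := by
  refine ⟨IsSynchronous₂.isRegular, fun h => isSynchronous₂_of_isRegular h fun u v => ⟨?_, ?_⟩⟩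
  · rintro ⟨u', v', he, hR⟩
    obtain ⟨rfl, rfl⟩ := padMap_injective he
    exact hR
  · exact fun hR => ⟨u, v, rfl, hR⟩

namespace IsSynchronous₂

variable {R S : List A → List A → Prop}

theorem congr (hR : IsSynchronous₂ R) (h : ∀ u v, S u v ↔ R u v) : IsSynchronous₂ S :=
  IsSynchronous.congr hR fun _ => h _ _

theorem not (hR : IsSynchronous₂ R) : IsSynchronous₂ fun u v => ¬ R u v :=
  IsSynchronous.not hR

theorem and (hR : IsSynchronous₂ R) (hS : IsSynchronous₂ S) :
    IsSynchronous₂ fun u v => R u v ∧ S u v :=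
  IsSynchronous.and hR hS

theorem or (hR : IsSynchronous₂ R) (hS : IsSynchronous₂ S) :
    IsSynchronous₂ fun u v => R u v ∨ S u v :=
  IsSynchronous.or hR hS

theorem left {L : Language A} (hL : L.IsRegular) : IsSynchronous₂ fun u _ => u ∈ L :=
  IsSynchronous.of_isRegular hL false

theorem right {L : Language A} (hL : L.IsRegular) : IsSynchronous₂ fun _ v => v ∈ L :=
  IsSynchronous.of_isRegular hL true

theorem eq : IsSynchronous₂ fun u v : List A => u = v :=
  IsSynchronous.eq false true

theorem comp (hR : IsSynchronous₂ R) (hS : IsSynchronous₂ S) :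
    IsSynchronous₂ fun u v => ∃ t, R u t ∧ S t v := by
  have h₁ := IsSynchronous.comap hR (ι := Option Bool) fun b => cond b none (some false)
  have h₂ := IsSynchronous.comap hS (ι := Option Bool) fun b => cond b (some true) none
  exact (h₁.and h₂).exists_word

theorem isRegular_exists (hR : IsSynchronous₂ R) : Language.IsRegular {u | ∃ v, R u v} := by
  obtain ⟨K, hK, h⟩ := hR.comp (S := fun _ _ => True) (IsSynchronous.eq false false |>.congr
    fun _ => by simp)
  have := hK.comap fun a : A => (fun _ => some a : Bool → Option A)
  refine this.congr fun u => ?_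
  have hu := h (fun _ => u) u.length fun _ => le_rfl
  simp only [and_true] at hu
  refine hu.symm.trans ?_
  change _ ↔ u.map _ ∈ K
  rw [show columns u.length (fun _ => u) = u.map fun a => (fun _ => some a : Bool → Option A) from
    List.ext_getElem (by simp) fun j h₁ h₂ => by
      rw [length_columns] at h₁
      simp [h₁]]

end IsSynchronous₂

end Binary

section Order

variable {A : Type*}

/-- The number whose base-`n + 1` digits, least significant first, are the letters of a word,
where the letter `a` has value `e a + 1`. -/
def numeral {n : ℕ} (e : A ≃ Fin n) : List A → ℕ
  | [] => 0
  | a :: u => (e a + 1) + (n + 1) * numeral e u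

theorem add_mul_lt_iff {B a b x y : ℕ} (ha : a < B) (hb : b < B) :
    a + B * x < b + B * y ↔ x < y ∨ x = y ∧ a < b := by
  rcases lt_trichotomy x y with h | rfl | h
  · have : B * (x + 1) ≤ B * y := Nat.mul_le_mul_left _ h
    rw [Nat.mul_succ] at this
    exact ⟨fun _ => Or.inl h, fun _ => by omega⟩
  · simp
  · have : B * (y + 1) ≤ B * x := Nat.mul_le_mul_left _ h
    rw [Nat.mul_succ] at this
    constructor <;> intro <;> omega

theorem add_mul_eq_iff {B a b x y : ℕ} (ha : a < B) (hb : b < B) :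
    a + B * x = b + B * y ↔ x = y ∧ a = b := by
  have h₁ := add_mul_lt_iff (x := x) (y := y) ha hb
  have h₂ := add_mul_lt_iff (x := y) (y := x) hb ha
  constructor
  · intro h
    omega
  · rintro ⟨rfl, rfl⟩
    rfl

theorem numeral_injective {n : ℕ} (e : A ≃ Fin n) : Function.Injective (numeral e) := by
  intro u v h
  induction u generalizing v with
  | nil =>
    cases v with
    | nil => rfl
    | cons b v =>
      simp only [numeral] at h
      omega
  | cons a u ih =>
    cases v with
    | nil =>
      simp only [numeral] at h
      omega
    | cons b v =>
      obtain ⟨h₁, h₂⟩ := (add_mul_eq_iff (by omega) (by omega)).1 h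
      rw [ih h₁, e.injective (Fin.ext (Nat.succ_injective h₂))]

theorem isSynchronous₂_numeral_lt {n : ℕ} (e : A ≃ Fin n) :
    IsSynchronous₂ fun u v => numeral e u < numeral e v := by
  let d : Option A → ℕ := fun o => o.elim 0 fun a => e a + 1
  have hd (o : Option A) : d o < n + 1 := by
    rcases o with _ | a
    · exact Nat.succ_pos n
    · exact Nat.succ_lt_succ (e a).2
  let f : Bool → Option A × Option A → Bool :=
    fun s c => if d c.1 = d c.2 then s else decide (d c.1 < d c.2)
  refine isSynchronous₂_of_isRegular (isRegular_foldl f false {true}) fun u v => ?_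
  suffices h : ∀ s, (padMap u v).foldl f s = true ↔
      numeral e u < numeral e v ∨ numeral e u = numeral e v ∧ s = true by
    exact (h false).trans (by simp)
  have step (c : Option A × Option A) (s : Bool) (x y : ℕ) : (x < y ∨ x = y ∧ f s c = true) ↔
      d c.1 + (n + 1) * x < d c.2 + (n + 1) * y ∨
        d c.1 + (n + 1) * x = d c.2 + (n + 1) * y ∧ s = true := by
    rw [add_mul_lt_iff (hd _) (hd _), add_mul_eq_iff (hd _) (hd _)]
    by_cases h : d c.1 = d c.2
    · simp [f, h]
    · simp [f, h]
  induction u generalizing v with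
  | nil =>
    induction v with
    | nil => simp [padMap, numeral]
    | cons b v ih =>
      intro s
      rw [padMap_nil_left] at ih ⊢
      rw [List.map_cons, List.foldl_cons, ih, step]
      simp [numeral, d]
  | cons a u ih =>
    intro s
    cases v with
    | nil =>
      have := ih []
      rw [padMap_nil_right] at this ⊢
      rw [List.map_cons, List.foldl_cons, this, step]
      simp [numeral, d]
    | cons b v =>
      rw [padMap_cons_cons, List.foldl_cons, ih, step]
      rfl

end Order

section Unique

variable {A : Type*} {M : Type*} [Monoid M]

/-- The value of a word under an interpretation of the letters. -/
def val (ψ : A → M) (w : List A) : M := (w.map ψ).prod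

variable (ψ : A → M)

@[simp]
theorem val_nil : val ψ [] = 1 := rfl

@[simp]
theorem val_cons (a : A) (w : List A) : val ψ (a :: w) = ψ a * val ψ w := List.prod_cons

@[simp]
theorem val_append (u v : List A) : val ψ (u ++ v) = val ψ u * val ψ v := by
  simp [val]

theorem evalWord_of_ne_nil {w : List A} (hw : w ≠ []) : evalWord ψ w = some (val ψ w) := by
  cases w with
  | nil => exact absurd rfl hw
  | cons a w => rw [evalWord, val, List.map_cons, List.prod_eq_foldl, List.foldl_cons, one_mul]

/-- An automatic structure with unique representatives on a monoid. -/
structure IsCrossSection (L : Language A) : Prop where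
  ne_nil : ∀ w ∈ L, w ≠ []
  regular : L.IsRegular
  onto : ∀ m : M, ∃ w ∈ L, val ψ w = m
  unique : ∀ u ∈ L, ∀ v ∈ L, val ψ u = val ψ v → u = v
  mul : ∀ a, IsSynchronous₂ fun u v => u ∈ L ∧ v ∈ L ∧ val ψ u * ψ a = val ψ v

variable {ψ} {L : Language A}

theorem IsCrossSection.mul_val (h : IsCrossSection ψ L) (w : List A) :
    IsSynchronous₂ fun u v => u ∈ L ∧ v ∈ L ∧ val ψ u * val ψ w = val ψ v := by
  induction w with
  | nil =>
    refine ((IsSynchronous₂.left h.regular).and .eq).congr fun u v => ?_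
    constructor
    · rintro ⟨hu, hv, huv⟩
      exact ⟨hu, h.unique u hu v hv (by simpa using huv)⟩
    · rintro ⟨hu, rfl⟩
      exact ⟨hu, hu, by simp⟩
  | cons a w ih =>
    refine ((h.mul a).comp ih).congr fun u v => ?_
    constructor
    · rintro ⟨hu, hv, huv⟩
      obtain ⟨t, ht, hut⟩ := h.onto (val ψ u * ψ a)
      exact ⟨t, ⟨hu, ht, hut.symm⟩, ht, hv, by rw [hut, mul_assoc, ← val_cons, huv]⟩
    · rintro ⟨t, ⟨hu, ht, hut⟩, -, hv, htv⟩
      exact ⟨hu, hv, by rw [← htv, ← hut, mul_assoc, val_cons]⟩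

theorem IsCrossSection.mul_right (h : IsCrossSection ψ L) (g : M) :
    IsSynchronous₂ fun u v => u ∈ L ∧ v ∈ L ∧ val ψ u * g = val ψ v := by
  obtain ⟨w, -, rfl⟩ := h.onto g
  exact h.mul_val w

end Unique

theorem isAutomaticSemigroup_iff {M : Type*} [Monoid M] : IsAutomaticSemigroup M ↔
    ∃ (A : Type) (_ : Finite A) (ψ : A → M) (L : Language A), IsCrossSection ψ L := by
  constructor
  · rintro ⟨A, hA, ψ, L, hL⟩
    obtain ⟨n, ⟨e⟩⟩ := Finite.exists_equiv_fin A
    have hval {u : List A} (hu : u ∈ L) : evalWord ψ u = some (val ψ u) :=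
      evalWord_of_ne_nil ψ (hL.nonempty_words u hu)
    have heq : IsSynchronous₂ fun u v => u ∈ L ∧ v ∈ L ∧ val ψ u = val ψ v := by
      refine isSynchronous₂_iff.2 (hL.eq_regular.congr fun p => ⟨?_, ?_⟩)
      · rintro ⟨u, v, rfl, hu, hv, h⟩
        exact ⟨u, hu, v, hv, rfl, by rw [hval hu, hval hv, h]⟩
      · rintro ⟨u, hu, v, hv, rfl, h⟩
        rw [hval hu, hval hv] at h
        exact ⟨u, v, rfl, hu, hv, Option.some.inj h⟩
    have hmul (a : A) : IsSynchronous₂ fun u v => u ∈ L ∧ v ∈ L ∧ val ψ u * ψ a = val ψ v := by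
      refine isSynchronous₂_iff.2 ((hL.mul_regular a).congr fun p => ⟨?_, ?_⟩)
      · rintro ⟨u, v, rfl, hu, hv, h⟩
        exact ⟨u, hu, v, hv, rfl, by
          rw [evalWord_of_ne_nil ψ (by simp), hval hv, val_append, val_cons, val_nil, mul_one, h]⟩
      · rintro ⟨u, hu, v, hv, rfl, h⟩
        rw [evalWord_of_ne_nil ψ (by simp), hval hv, val_append, val_cons, val_nil, mul_one] at h
        exact ⟨u, v, rfl, hu, hv, Option.some.inj h⟩
    let less : Language A :=
      {u | ∃ v, (u ∈ L ∧ v ∈ L ∧ val ψ u = val ψ v) ∧ ¬ numeral e u ≤ numeral e v}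
    have hless : less.IsRegular := by
      refine (heq.and (S := fun u v => ¬ numeral e u ≤ numeral e v) ?_).isRegular_exists
      refine (((isSynchronous₂_numeral_lt e).or .eq).not).congr fun u v => ?_
      rw [le_iff_lt_or_eq, (numeral_injective e).eq_iff]
    have hL' : (L ⊓ lessᶜ).IsRegular := hL.regular.inf hless.compl
    refine ⟨A, hA, ψ, L ⊓ lessᶜ, ⟨fun w hw => hL.nonempty_words w hw.1, hL', fun m => ?_,
      fun u hu v hv h => ?_, fun a => ?_⟩⟩
    · have hne : {w | w ∈ L ∧ val ψ w = m}.Nonempty := by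
        obtain ⟨w, hw, hwm⟩ := hL.onto m
        rw [hval hw] at hwm
        exact ⟨w, hw, Option.some.inj hwm⟩
      obtain ⟨w, ⟨hw, hwm⟩, hmin⟩ :=
        (InvImage.wf (numeral e) wellFounded_lt).has_min _ hne
      refine ⟨w, ⟨hw, ?_⟩, hwm⟩
      rintro ⟨v, ⟨-, hv, hwv⟩, hlt⟩
      exact hmin v ⟨hv, hwv.symm.trans hwm⟩ (not_le.1 hlt)
    · refine numeral_injective e (le_antisymm ?_ ?_)
      · by_contra hc
        exact hu.2 ⟨v, ⟨hu.1, hv.1, h⟩, hc⟩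
      · by_contra hc
        exact hv.2 ⟨u, ⟨hv.1, hu.1, h.symm⟩, hc⟩
    · refine ((hmul a).and ((IsSynchronous₂.left hL').and (.right hL'))).congr fun u v => ?_
      constructor
      · rintro ⟨hu, hv, h⟩
        exact ⟨⟨hu.1, hv.1, h⟩, hu, hv⟩
      · rintro ⟨⟨-, -, h⟩, hu, hv⟩
        exact ⟨hu, hv, h⟩
  · rintro ⟨A, hA, ψ, L, hL⟩
    have hval {u : List A} (hu : u ∈ L) : evalWord ψ u = some (val ψ u) :=
      evalWord_of_ne_nil ψ (hL.ne_nil u hu)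
    refine ⟨A, hA, ψ, L, ⟨hL.ne_nil, hL.regular, fun m => ?_, ?_, fun a => ?_⟩⟩
    · obtain ⟨w, hw, rfl⟩ := hL.onto m
      exact ⟨w, hw, hval hw⟩
    · refine (isSynchronous₂_iff.1 ((IsSynchronous₂.left hL.regular).and .eq)).congr fun p => ?_
      constructor
      · rintro ⟨u, hu, v, hv, rfl, h⟩
        rw [hval hu, hval hv] at h
        exact ⟨u, v, rfl, hu, hL.unique u hu v hv (Option.some.inj h)⟩
      · rintro ⟨u, v, rfl, hu, rfl⟩
        exact ⟨u, hu, u, hu, rfl, rfl⟩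
    · refine (isSynchronous₂_iff.1 (hL.mul a)).congr fun p => ?_
      constructor
      · rintro ⟨u, hu, v, hv, rfl, h⟩
        rw [evalWord_of_ne_nil ψ (by simp), hval hv, val_append, val_cons, val_nil, mul_one] at h
        exact ⟨u, v, rfl, hu, hv, Option.some.inj h⟩
      · rintro ⟨u, v, rfl, hu, hv, h⟩
        exact ⟨u, hu, v, hv, rfl, by
          rw [evalWord_of_ne_nil ψ (by simp), hval hv, val_append, val_cons, val_nil, mul_one, h]⟩

theorem IsAutomaticSemigroup.of_mulEquiv {M N : Type*} [Monoid M] [Monoid N] (f : M ≃* N)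
    (h : IsAutomaticSemigroup M) : IsAutomaticSemigroup N := by
  rw [isAutomaticSemigroup_iff] at h ⊢
  obtain ⟨A, hA, ψ, L, hL⟩ := h
  have hval (w : List A) : val (f ∘ ψ) w = f (val ψ w) := by
    rw [val, val, map_list_prod, List.map_map]
  refine ⟨A, hA, f ∘ ψ, L, ⟨hL.ne_nil, hL.regular, fun n => ?_, fun u hu v hv h => ?_,
    fun a => (hL.mul a).congr fun u v => ?_⟩⟩
  · obtain ⟨w, hw, h⟩ := hL.onto (f.symm n)
    exact ⟨w, hw, by rw [hval, h, f.apply_symm_apply]⟩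
  · rw [hval, hval] at h
    exact hL.unique u hu v hv (f.injective h)
  · rw [hval, hval, Function.comp_apply, ← map_mul, f.injective.eq_iff]

section FreeProduct

open Monoid Monoid.CoprodI

variable {ι : Type*} {M : ι → Type*} [∀ i, Monoid (M i)]

/-- The elements of a free product whose reduced form does not start with a letter from the
factor `i`. -/
def notStarting (M : ι → Type*) [∀ i, Monoid (M i)] (i : ι) : Set (CoprodI M) :=
  {g | ∃ w : Word M, w.fstIdx ≠ some i ∧ w.prod = g}

variable {i : ι}

theorem one_mem_notStarting : 1 ∈ notStarting M i := ⟨Word.empty, by simp [Word.fstIdx], rfl⟩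

theorem exists_eq_of_mul (i : ι) (g : CoprodI M) :
    ∃ s : M i, ∃ n ∈ notStarting M i, g = of s * n := by
  classical
  refine ⟨(Word.equivPair i (Word.equiv g)).head, _,
    ⟨(Word.equivPair i (Word.equiv g)).tail, (Word.equivPair i (Word.equiv g)).fstIdx_ne, rfl⟩, ?_⟩
  rw [← Word.prod_rcons, ← Word.equivPair_symm, Equiv.symm_apply_apply]
  exact (Word.equiv.symm_apply_apply g).symm

theorem of_mul_inj {s s' : M i} {n n' : CoprodI M} (hn : n ∈ notStarting M i)
    (hn' : n' ∈ notStarting M i) (h : of s * n = of s' * n') : s = s' ∧ n = n' := by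
  classical
  obtain ⟨w, hw, rfl⟩ := hn
  obtain ⟨w', hw', rfl⟩ := hn'
  have key : Word.rcons ⟨s, w, hw⟩ = Word.rcons ⟨s', w', hw'⟩ := by
    apply Word.equiv.symm.injective
    change Word.prod _ = Word.prod _
    rw [Word.prod_rcons, Word.prod_rcons, h]
  have := Word.rcons_inj key
  simp only [Word.Pair.mk.injEq] at this
  exact ⟨this.1, this.2 ▸ rfl⟩

theorem exists_word_mul_of {k j : ι} (x : M j) (w : Word M) (hw : w.fstIdx = some k) :
    ∃ w' : Word M, w'.prod = w.prod * of x ∧ (w'.fstIdx = some k ∨ w' = Word.empty) := by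
  classical
  induction w using Word.consRecOn generalizing k with
  | empty => simp [Word.fstIdx] at hw
  | cons l m w h1 h2 ih =>
    obtain rfl : l = k := by simpa using hw
    by_cases hx : x = 1
    · exact ⟨_, by rw [hx, map_one, mul_one], Or.inl hw⟩
    rcases hwk : w.fstIdx with _ | k
    · obtain rfl : w = Word.empty := by
        ext1
        simpa [Word.fstIdx] using hwk
      by_cases hjl : j = l
      · subst hjl
        by_cases hmx : m * x = 1
        · refine ⟨Word.empty, ?_, Or.inr rfl⟩
          rw [Word.prod_cons, Word.prod_empty, mul_one, ← map_mul, hmx, map_one]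
        · refine ⟨Word.cons (m * x) Word.empty h1 hmx, ?_, Or.inl (by simp)⟩
          rw [Word.prod_cons, Word.prod_cons, Word.prod_empty, mul_one, mul_one, map_mul]
      · refine ⟨Word.cons m (Word.cons x Word.empty (by simp [Word.fstIdx]) hx) (by simpa using hjl)
          h2, ?_, Or.inl (by simp)⟩
        simp
    · obtain ⟨w', hw', h⟩ := ih hwk
      have h1' : w'.fstIdx ≠ some l := by
        rcases h with h | rfl
        · rw [h, ← hwk]
          exact h1
        · simp [Word.fstIdx]
      refine ⟨Word.cons m w' h1' h2, ?_, Or.inl (by simp)⟩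
      rw [Word.prod_cons, hw', Word.prod_cons, mul_assoc]

theorem mul_of_mem_notStarting {y : CoprodI M} (hy : y ∈ notStarting M i) (hy1 : y ≠ 1) {j : ι}
    (x : M j) : y * of x ∈ notStarting M i := by
  obtain ⟨w, hw, rfl⟩ := hy
  rcases hwk : w.fstIdx with _ | k
  · refine absurd ?_ hy1
    obtain rfl : w = Word.empty := by
      ext1
      simpa [Word.fstIdx] using hwk
    rfl
  · obtain ⟨w', hw', h⟩ := exists_word_mul_of x w hwk
    refine ⟨w', ?_, hw'⟩
    rcases h with h | rfl
    · rw [h, ← hwk]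
      exact hw
    · simp [Word.fstIdx]

/-- Multiplying a reduced element by `g` can only affect its first letter after cancelling the
element completely by one of finitely many left divisors of `g`. -/
theorem exists_finite_splitting (i : ι) (g : CoprodI M) :
    ∃ F : Set (CoprodI M × CoprodI M), F.Finite ∧ (∀ p ∈ F, p.1 * p.2 = g) ∧
      ∀ y ∈ notStarting M i, y * g ∉ notStarting M i → ∃ p ∈ F, y * p.1 = 1 := by
  induction g using CoprodI.induction_on with
  | one => exact ⟨∅, Set.finite_empty, by simp, fun y hy h => absurd (by simpa using hy) h⟩
  | of j x =>
    refine ⟨{(1, of x)}, Set.finite_singleton _, by simp, fun y hy h => ⟨_, rfl, ?_⟩⟩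
    by_contra hy1
    exact h (mul_of_mem_notStarting hy (by simpa using hy1) x)
  | mul g k ihg ihk =>
    obtain ⟨F, hF, hFg, hFs⟩ := ihg
    obtain ⟨F', hF', hFk, hFs'⟩ := ihk
    refine ⟨(fun p => (p.1, p.2 * k)) '' F ∪ (fun p => (g * p.1, p.2)) '' F',
      (hF.image _).union (hF'.image _), ?_, fun y hy h => ?_⟩
    · rintro _ (⟨p, hp, rfl⟩ | ⟨p, hp, rfl⟩)
      · rw [← hFg p hp, mul_assoc]
      · rw [← hFk p hp, mul_assoc]
    · by_cases hg : y * g ∈ notStarting M i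
      · obtain ⟨p, hp, hy⟩ := hFs' _ hg (by rwa [mul_assoc])
        exact ⟨_, Or.inr ⟨p, hp, rfl⟩, by rw [← hy, mul_assoc]⟩
      · obtain ⟨p, hp, hy⟩ := hFs _ hy hg
        exact ⟨_, Or.inl ⟨p, hp, rfl⟩, hy⟩

section Words

variable {A : Type*} [Finite A] (ψ : A → CoprodI M)

theorem exists_finite_return (i : ι) : ∃ E : Set (List A × CoprodI M × CoprodI M), E.Finite ∧
    (∀ e ∈ E, val ψ e.1 = e.2.1 * e.2.2) ∧
    ∀ r, ∀ y ∈ notStarting M i, y * val ψ r ∈ Set.range (of : M i → CoprodI M) →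
      ∃ e ∈ E, ∃ u v, r = u ++ e.1 ++ v ∧ y * val ψ u * e.2.1 = 1 := by
  choose F hF hFm hFs using fun a => exists_finite_splitting i (ψ a)
  refine ⟨{([], 1, 1)} ∪ ⋃ a, (fun p => ([a], p)) '' F a,
    (Set.finite_singleton _).union (Set.finite_iUnion fun a => (hF a).image _), ?_, ?_⟩
  · rintro e (rfl | he)
    · simp
    · obtain ⟨a, p, hp, rfl⟩ := Set.mem_iUnion.1 he
      simpa using (hFm a p hp).symm
  · intro r
    induction r with
    | nil =>
      rintro y hy ⟨s, hs⟩
      refine ⟨([], 1, 1), Or.inl rfl, [], [], rfl, ?_⟩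
      have : (1 : M i) = s ∧ y = 1 := of_mul_inj hy one_mem_notStarting (by
        simpa using hs.symm)
      simp [this.2]
    | cons a r ih =>
      intro y hy hr
      by_cases hya : y * ψ a ∈ notStarting M i
      · obtain ⟨e, he, u, v, rfl, h⟩ := ih _ hya (by rwa [mul_assoc, ← val_cons])
        exact ⟨e, he, a :: u, v, by simp, by rw [← h, val_cons, mul_assoc y (ψ a)]⟩
      · obtain ⟨p, hp, h⟩ := hFs a y hy hya
        exact ⟨_, Or.inr (Set.mem_iUnion.2 ⟨a, p, hp, rfl⟩), [], r, rfl, by simpa using h⟩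

theorem exists_finite_departure (i : ι) : ∃ E : Set (List A × CoprodI M × CoprodI M), E.Finite ∧
    (∀ e ∈ E, val ψ e.1 = e.2.1 * e.2.2) ∧
    ∀ r, ∃ e ∈ E, ∃ u v, r = u ++ e.1 ++ v ∧ e.2.2 * val ψ v ∈ notStarting M i ∧
      val ψ u * e.2.1 ∈ Set.range (of : M i → CoprodI M) := by
  choose F hF hFm hFs using fun a => exists_finite_splitting i (ψ a)
  choose s n hn hsn using exists_eq_of_mul (M := M) i
  let E : Set (List A × CoprodI M × CoprodI M) :=
    {([], 1, 1)} ∪ ⋃ a, (fun p => ([a], p.1 * of (s p.2), n p.2)) '' F a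
  have hEm : ∀ e ∈ E, val ψ e.1 = e.2.1 * e.2.2 := by
    rintro e (rfl | he)
    · simp
    · obtain ⟨a, p, hp, rfl⟩ := Set.mem_iUnion.1 he
      simp [mul_assoc, ← hsn, hFm a p hp]
  refine ⟨E, (Set.finite_singleton _).union (Set.finite_iUnion fun a => (hF a).image _), hEm, ?_⟩
  intro r
  induction r using List.reverseRecOn with
  | nil =>
    exact ⟨_, Or.inl rfl, [], [], rfl, by simpa using one_mem_notStarting, 1, by simp⟩
  | append_singleton r a ih =>
    obtain ⟨e, he, u, v, rfl, hv, h, hu⟩ := ih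
    by_cases hva : e.2.2 * val ψ v * ψ a ∈ notStarting M i
    · exact ⟨e, he, u, v ++ [a], by simp, by simpa [mul_assoc] using hva, h, hu⟩
    · obtain ⟨p, hp, hp1⟩ := hFs a _ hv hva
      refine ⟨_, Or.inr (Set.mem_iUnion.2 ⟨a, p, hp, rfl⟩), _, [], (List.append_nil _).symm,
        by simpa using hn p.2, h * s p.2, ?_⟩
      simp only [mul_assoc] at hp1
      rw [map_mul, hu, val_append, val_append, hEm e he]
      simp only [mul_assoc]
      rw [← mul_assoc (val ψ v), ← mul_assoc e.2.2, hp1, one_mul]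

end Words

theorem finite_infixes {A : Type*} {N : Type*} [Monoid N] {ψ : A → N} {L : Language A}
    (hreg : L.IsRegular) (huniq : ∀ u ∈ L, ∀ v ∈ L, val ψ u = val ψ v → u = v)
    {C : Set N} (hC : C.Finite) : {w | val ψ w ∈ C ∧ ∃ p r, p ++ w ++ r ∈ L}.Finite := by
  have h : ∀ w, ∃ p, (∃ p r, p ++ w ++ r ∈ L) → ∃ r, p ++ w ++ r ∈ L := fun w => by
    by_cases hw : ∃ p r, p ++ w ++ r ∈ L
    · obtain ⟨p, hp⟩ := hw
      exact ⟨p, fun _ => hp⟩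
    · exact ⟨[], fun h => absurd h hw⟩
  choose p hp using h
  refine Set.Finite.of_finite_image (f := fun w => (L.leftQuotient (p w),
    L.leftQuotient (p w ++ w), val ψ w)) ((hreg.finite_range_leftQuotient.prod
      (hreg.finite_range_leftQuotient.prod hC)).subset ?_) ?_
  · rintro _ ⟨w, hw, rfl⟩
    exact ⟨⟨_, rfl⟩, ⟨_, rfl⟩, hw.1⟩
  · rintro w ⟨-, hw⟩ w' - h
    simp only [Prod.mk.injEq] at h
    obtain ⟨h₁, h₂, h₃⟩ := h
    obtain ⟨r, hr⟩ := hp w hw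
    have hr' : w' ++ r ∈ L.leftQuotient (p w) := by
      have : r ∈ L.leftQuotient (p w ++ w) := hr
      rw [h₂] at this
      rw [h₁]
      change p w' ++ (w' ++ r) ∈ L
      rw [← List.append_assoc]
      exact this
    have := huniq _ hr _ hr' (by simp [h₃])
    rw [List.append_assoc, List.append_cancel_left_eq, List.append_cancel_right_eq] at this
    exact this

theorem isRegular_factor {A : Type*} [Finite A] {ψ : A → CoprodI M} {L : Language A}
    (hreg : L.IsRegular) (huniq : ∀ u ∈ L, ∀ v ∈ L, val ψ u = val ψ v → u = v) (i : ι) :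
    Language.IsRegular ({u | u ∈ L ∧ val ψ u ∈ Set.range (of : M i → CoprodI M)} :
      Language A) := by
  obtain ⟨E, hE, hEm, hEs⟩ := exists_finite_departure ψ i
  obtain ⟨E', hE', hEm', hEs'⟩ := exists_finite_return ψ i
  have hD := finite_infixes hreg huniq (hE.image2 (fun e e' => e.2.1 * e'.2.2) hE')
  have hZ := hE.image2 (fun e q => e.2.2 * val ψ q)
    (hD.biUnion (t := fun w => {q | q <:+: w}) fun w _ => by
      classical exact ((w.sublists.finite_toSet).subset fun q hq =>
        List.mem_sublists.2 hq.sublist))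
  refine isRegular_of_finite_cover (hreg.finite_range_leftQuotient.image2
    (fun l y => ({r | r ∈ l ∧ y * val ψ r ∈ Set.range (of : M i → CoprodI M)} : Language A)) hZ) ?_
  rintro p r ⟨hpr, h, hh⟩
  obtain ⟨e, he, u, v, rfl, hv, s, hs⟩ := hEs p
  have hp : val ψ (u ++ e.1 ++ v) = of s * (e.2.2 * val ψ v) := by
    rw [hs, val_append, val_append, hEm e he]
    simp only [mul_assoc]
  have hr : e.2.2 * val ψ v * val ψ r ∈ Set.range (of : M i → CoprodI M) := by
    obtain ⟨t, n, hn, htn⟩ := exists_eq_of_mul i (e.2.2 * val ψ v * val ψ r)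
    rw [val_append, hp, mul_assoc, htn, ← mul_assoc, ← map_mul, ← mul_one (of h)] at hh
    refine ⟨t, ?_⟩
    rw [htn, ← (of_mul_inj one_mem_notStarting hn hh).2, mul_one]
  obtain ⟨e', he', u', v', rfl, hu'⟩ := hEs' r _ hv hr
  refine ⟨_, ⟨_, ⟨u ++ e.1 ++ v, rfl⟩, _, ⟨e, he, v, Set.mem_biUnion (x := e.1 ++ v ++ (u' ++ e'.1))
    ⟨⟨e, he, e', he', ?_⟩, u, v', ?_⟩ ⟨e.1, u' ++ e'.1, rfl⟩, rfl⟩, rfl⟩, ⟨hpr, hr⟩, ?_⟩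
  · simp only [val_append, hEm e he, hEm' e' he']
    simp only [mul_assoc] at hu' ⊢
    rw [← mul_assoc (val ψ u'), ← mul_assoc (val ψ v), ← mul_assoc e.2.2, hu', one_mul]
  · simpa using hpr
  · rintro z ⟨hz, t, ht⟩
    refine ⟨hz, s * t, ?_⟩
    rw [map_mul, ht, val_append, hp]
    simp only [mul_assoc]

theorem isCrossSection_factor {A : Type*} [Finite A] {ψ : A → CoprodI M} {L : Language A}
    (hL : IsCrossSection ψ L) (i : ι) (π : CoprodI M →* M i) (hπ : ∀ x, π (of x) = x) :
    IsCrossSection (π ∘ ψ) {u | u ∈ L ∧ val ψ u ∈ Set.range (of : M i → CoprodI M)} := by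
  have hreg := isRegular_factor hL.regular hL.unique i
  have hval (w : List A) : val (π ∘ ψ) w = π (val ψ w) := by
    rw [val, val, map_list_prod, List.map_map]
  refine ⟨fun w hw => hL.ne_nil w hw.1, hreg, fun m => ?_, ?_, fun a => ?_⟩
  · obtain ⟨w, hw, hwm⟩ := hL.onto (of m)
    exact ⟨w, ⟨hw, m, hwm.symm⟩, by rw [hval, hwm, hπ]⟩
  · rintro u ⟨hu, s, hs⟩ v ⟨hv, t, ht⟩ h
    rw [hval, hval, ← hs, ← ht, hπ, hπ] at h
    exact hL.unique u hu v hv (by rw [← hs, ← ht, h])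
  · refine ((hL.mul_right (of (π (ψ a)))).and
      ((IsSynchronous₂.left hreg).and (.right hreg))).congr fun u v => ?_
    constructor
    · rintro ⟨⟨hu, s, hs⟩, ⟨hv, t, ht⟩, h⟩
      rw [hval, hval, ← hs, ← ht, hπ, hπ] at h
      refine ⟨⟨hu, hv, ?_⟩, ⟨hu, s, hs⟩, hv, t, ht⟩
      rw [← hs, ← ht, ← h, map_mul, Function.comp_apply]
    · rintro ⟨⟨-, -, h⟩, hu, hv⟩
      refine ⟨hu, hv, ?_⟩
      rw [hval, hval, ← h, map_mul, hπ, Function.comp_apply]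

theorem isAutomaticSemigroup_of_coprodI (h : IsAutomaticSemigroup (CoprodI M)) (i : ι) :
    IsAutomaticSemigroup (M i) := by
  classical
  rw [isAutomaticSemigroup_iff] at h ⊢
  obtain ⟨A, hA, ψ, L, hL⟩ := h
  exact ⟨A, hA, _, _, isCrossSection_factor hL i _ (of_leftInverse i)⟩

end FreeProduct

section Combinators

variable {A B : Type*} {R : List A → List A → Prop}

theorem IsSynchronous₂.map (hR : IsSynchronous₂ R) (f : A → B) :
    IsSynchronous₂ fun u v => ∃ u' v', R u' v' ∧ u'.map f = u ∧ v'.map f = v := by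
  refine isSynchronous₂_iff.2
    ((hR.isRegular.map (Prod.map (Option.map f) (Option.map f))).congr fun p => ⟨?_, ?_⟩)
  · rintro ⟨_, _, rfl, u, v, h, rfl, rfl⟩
    exact ⟨_, ⟨u, v, rfl, h⟩, (padMap_map f u v).symm⟩
  · rintro ⟨_, ⟨u, v, rfl, h⟩, rfl⟩
    exact ⟨_, _, (padMap_map f u v).symm, u, v, h, rfl, rfl⟩

theorem IsSynchronous₂.prepend (hR : IsSynchronous₂ R) {P : Language A} (hP : P.IsRegular) :
    IsSynchronous₂ fun u v => ∃ x ∈ P, ∃ u' v', R u' v' ∧ x ++ u' = u ∧ x ++ v' = v := by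
  refine isSynchronous₂_iff.2
    (((hP.map fun a => (some a, some a)).mul hR.isRegular).congr fun p => ⟨?_, ?_⟩)
  · rintro ⟨_, _, rfl, x, hx, u, v, h, rfl, rfl⟩
    exact ⟨_, ⟨x, hx, rfl⟩, _, ⟨u, v, rfl, h⟩, (padMap_append_left x u v).symm⟩
  · rintro ⟨_, ⟨x, hx, rfl⟩, _, ⟨u, v, rfl, h⟩, rfl⟩
    exact ⟨_, _, (padMap_append_left x u v).symm, x, hx, u, v, h, rfl, rfl⟩

end Combinators

section Reduced

open Monoid Monoid.CoprodI

variable {ι : Type*} {M : ι → Type*} [∀ i, Monoid (M i)]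

/-- A list of syllables is reduced if no syllable is trivial and adjacent syllables come from
different factors. -/
def IsReduced (l : List (Σ i, M i)) : Prop :=
  (∀ x ∈ l, x.2 ≠ 1) ∧ l.IsChain fun x y => x.1 ≠ y.1

/-- The element of the free product spelled by a list of syllables. -/
def syllableProd (l : List (Σ i, M i)) : CoprodI M := (l.map fun x => of x.2).prod

theorem exists_isReduced (g : CoprodI M) : ∃ l, IsReduced l ∧ syllableProd l = g := by
  classical
  exact ⟨(Word.equiv g).toList, ⟨(Word.equiv g).ne_one, (Word.equiv g).chain_ne⟩,
    Word.equiv.symm_apply_apply g⟩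

theorem IsReduced.eq {l l' : List (Σ i, M i)} (hl : IsReduced l) (hl' : IsReduced l')
    (h : syllableProd l = syllableProd l') : l = l' := by
  classical
  have : (⟨l, hl.1, hl.2⟩ : Word M) = ⟨l', hl'.1, hl'.2⟩ := Word.equiv.symm.injective h
  exact congrArg Word.toList this

open Classical in
/-- The reduced list of syllables spelling an element of a factor. -/
noncomputable def syllable (i : ι) (m : M i) : List (Σ i, M i) := if m = 1 then [] else [⟨i, m⟩]

@[simp]
theorem syllableProd_append (l l' : List (Σ i, M i)) :
    syllableProd (l ++ l') = syllableProd l * syllableProd l' := by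
  simp [syllableProd]

@[simp]
theorem syllableProd_syllable (i : ι) (m : M i) : syllableProd (syllable i m) = of m := by
  by_cases hm : m = 1 <;> simp [syllable, syllableProd, hm]

/-- The reduced lists not ending in a syllable from the factor `i`. -/
def reducedNotEnding (M : ι → Type*) [∀ i, Monoid (M i)] (i : ι) : Set (List (Σ i, M i)) :=
  {l | IsReduced l ∧ ∀ x ∈ l.getLast?, x.1 ≠ i}

theorem isReduced_append_syllable {i : ι} {l : List (Σ i, M i)} (hl : l ∈ reducedNotEnding M i)
    (m : M i) : IsReduced (l ++ syllable i m) := by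
  by_cases hm : m = 1
  · simpa [syllable, hm] using hl.1
  · simp only [syllable, hm, if_false]
    refine ⟨?_, List.isChain_append.2 ⟨hl.1.2, List.isChain_singleton _, ?_⟩⟩
    · intro x hx
      rcases List.mem_append.1 hx with hx | hx
      · exact hl.1.1 x hx
      · rw [List.mem_singleton.1 hx]
        exact hm
    · rintro x hx y hy
      obtain rfl : ⟨i, m⟩ = y := by simpa using hy
      exact hl.2 x hx

theorem exists_append_syllable (i : ι) {l : List (Σ i, M i)} (hl : IsReduced l) :
    ∃ l' ∈ reducedNotEnding M i, ∃ m : M i, l = l' ++ syllable i m := by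
  rcases List.eq_nil_or_concat' l with rfl | ⟨l', ⟨j, x⟩, rfl⟩
  · exact ⟨[], ⟨hl, by simp⟩, 1, by simp [syllable]⟩
  · by_cases hj : j = i
    · subst hj
      have h := List.isChain_append.1 hl.2
      refine ⟨l', ⟨⟨fun y hy => hl.1 y (by simp [hy]), h.1⟩,
          fun y hy => h.2.2 y hy ⟨j, x⟩ (by simp)⟩,
        x, ?_⟩
      have hx : x ≠ 1 := hl.1 ⟨j, x⟩ (by simp)
      simp [syllable, hx]
    · exact ⟨_, ⟨hl, by simpa using hj⟩, 1, by simp [syllable]⟩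

end Reduced

section Encode

open Monoid Monoid.CoprodI
open scoped Computability

variable {ι : Type*} {M : ι → Type*} {A : ι → Type*}

/-- The inclusion of an alphabet into the common alphabet with an additional marker `none`. -/
def letter (i : ι) (a : A i) : Option (Σ i, A i) := some ⟨i, a⟩

/-- The concatenation of the representatives of a list of syllables. -/
def encode (r : ∀ i, M i → List (A i)) (l : List (Σ i, M i)) : List (Option (Σ i, A i)) :=
  l.flatMap fun x => (r x.1 x.2).map (letter x.1)

variable (r : ∀ i, M i → List (A i))

theorem encode_cons (x : Σ i, M i) (l : List (Σ i, M i)) :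
    encode r (x :: l) = (r x.1 x.2).map (letter x.1) ++ encode r l := rfl

theorem encode_append (l l' : List (Σ i, M i)) :
    encode r (l ++ l') = encode r l ++ encode r l' := List.flatMap_append

variable [∀ i, Monoid (M i)]

/-- The language of representatives of nontrivial elements of a factor. -/
def syllableLanguage (i : ι) : Language (Option (Σ i, A i)) :=
  {w | ∃ m : M i, m ≠ 1 ∧ (r i m).map (letter i) = w}

theorem isReduced_cons {x : Σ i, M i} {l : List (Σ i, M i)} :
    IsReduced (x :: l) ↔ x.2 ≠ 1 ∧ (∀ y ∈ l.head?, x.1 ≠ y.1) ∧ IsReduced l := by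
  simp only [IsReduced, List.forall_mem_cons, List.isChain_cons]
  tauto

variable {i j : ι}

theorem mem_kstar_pair_iff (hij : i ≠ j) (h : ∀ k, k = i ∨ k = j)
    (w : List (Option (Σ i, A i))) :
    w ∈ (1 + syllableLanguage r j) * (syllableLanguage r i * syllableLanguage r j)∗ ↔
      ∃ l ∈ reducedNotEnding M i, encode r l = w := by
  constructor
  · rintro ⟨x, hx, _, ⟨z, rfl, hz⟩, rfl⟩
    have key : ∃ l ∈ reducedNotEnding M i, encode r l = z.flatten ∧ ∀ y ∈ l.head?, y.1 ≠ j := by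
      induction z with
      | nil => exact ⟨[], ⟨⟨by simp, List.isChain_nil⟩, by simp⟩, rfl, by simp⟩
      | cons z zs ih =>
        obtain ⟨⟨_, ⟨m, hm, rfl⟩, _, ⟨n, hn, rfl⟩, rfl⟩, hzs⟩ := List.forall_mem_cons.1 hz
        obtain ⟨l, ⟨hl, hll⟩, hlz, hlj⟩ := ih hzs
        refine ⟨⟨i, m⟩ :: ⟨j, n⟩ :: l, ⟨isReduced_cons.2 ⟨hm, by simpa using hij,
          isReduced_cons.2 ⟨hn, fun y hy => (hlj y hy).symm, hl⟩⟩, ?_⟩, ?_, by simpa using hij⟩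
        · cases l with
          | nil => simpa using hij.symm
          | cons y l => simpa [List.getLast?_cons_cons] using hll
        · rw [encode_cons, encode_cons, hlz, List.flatten_cons]
          exact (List.append_assoc _ _ _).symm
    obtain ⟨l, ⟨hl, hll⟩, hlz, hlj⟩ := key
    rcases hx with hx | ⟨n, hn, rfl⟩
    · obtain rfl : x = [] := hx
      exact ⟨l, ⟨hl, hll⟩, hlz⟩
    · refine ⟨⟨j, n⟩ :: l, ⟨isReduced_cons.2 ⟨hn, fun y hy => (hlj y hy).symm, hl⟩, ?_⟩, ?_⟩
      · cases l with
        | nil => simpa using hij.symm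
        | cons y l => simpa [List.getLast?_cons_cons] using hll
      · rw [encode_cons, hlz]
  · rintro ⟨l, ⟨hl, hll⟩, rfl⟩
    have key : ((∀ y ∈ l.head?, y.1 ≠ j) →
        encode r l ∈ (syllableLanguage r i * syllableLanguage r j)∗) ∧
        ((∃ y ∈ l.head?, y.1 = j) → encode r l ∈
          syllableLanguage r j * (syllableLanguage r i * syllableLanguage r j)∗) := by
      induction l with
      | nil => exact ⟨fun _ => ⟨[], rfl, by simp⟩, by simp⟩
      | cons y l ih =>
        obtain ⟨hy, hyl, hl⟩ := isReduced_cons.1 hl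
        have hll' : ∀ x ∈ l.getLast?, x.1 ≠ i := by
          cases l with
          | nil => simp
          | cons z l => simpa [List.getLast?_cons_cons] using hll
        obtain ⟨ih₁, ih₂⟩ := ih hl hll'
        obtain ⟨k, y⟩ := y
        constructor
        · intro hk
          obtain rfl : k = i := (h k).resolve_right (hk _ rfl)
          cases l with
          | nil => exact absurd rfl (hll ⟨k, y⟩ rfl)
          | cons z l =>
            obtain ⟨a, ha, b, ⟨zs, rfl, hzs⟩, hab⟩ :=
              ih₂ ⟨z, rfl, (h z.1).resolve_left (hyl z rfl).symm⟩
            rw [encode_cons, ← hab]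
            refine ⟨(_ ++ a) :: zs, by simp,
              List.forall_mem_cons.2 ⟨⟨_, ⟨y, hy, rfl⟩, a, ha, rfl⟩, hzs⟩⟩
        · rintro ⟨_, ⟨⟩, rfl⟩
          exact ⟨_, ⟨y, hy, rfl⟩, _, ih₁ fun z hz => (hyl z hz).symm, rfl⟩
    by_cases hj : ∃ y ∈ l.head?, y.1 = j
    · obtain ⟨a, ha, b, hb, hab⟩ := key.2 hj
      exact ⟨a, Or.inr ha, b, hb, hab⟩
    · exact ⟨[], Or.inl rfl, _, key.1 fun y hy hyj => hj ⟨y, hy, hyj⟩, rfl⟩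

end Encode

open Monoid Monoid.CoprodI

section FreeProductStructure

variable {ι : Type*} {M : ι → Type*} [∀ i, Monoid (M i)] {A : ι → Type*}

/-- The letters of the free product: the letters of all factors and a trivial marker. -/
def letterValue (ψ : ∀ i, A i → M i) : Option (Σ i, A i) → CoprodI M
  | none => 1
  | some ⟨i, a⟩ => of (ψ i a)

open Classical in
/-- The representative of an element of a factor, with the trivial element represented by the
empty word. -/
noncomputable def reducedRep {i : ι} (r : M i → List (A i)) (m : M i) : List (A i) :=
  if m = 1 then [] else r m

variable {ψ : ∀ i, A i → M i} {r : ∀ i, M i → List (A i)} {L : ∀ i, Language (A i)}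

theorem val_letterValue_encode (hr : ∀ i m, val (ψ i) (r i m) = m) (l : List (Σ i, M i)) :
    val (letterValue ψ) (encode r l) = syllableProd l := by
  induction l with
  | nil => rfl
  | cons x l ih =>
    have h (i : ι) (w : List (A i)) :
        val (letterValue ψ) (w.map (letter i)) = of (val (ψ i) w) := by
      rw [val, val, map_list_prod, List.map_map, List.map_map]
      rfl
    rw [encode_cons, val_append, ih, h, hr]
    simp [syllableProd]

theorem encode_syllable (i : ι) (m : M i) :
    encode r (syllable i m) = (reducedRep (r i) m).map (letter i) := by
  by_cases hm : m = 1 <;> simp [syllable, reducedRep, encode, hm]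

theorem isSynchronous₂_reducedRep {i : ι} (hL : IsCrossSection (ψ i) (L i))
    (hrL : ∀ m, r i m ∈ L i) (hr : ∀ m, val (ψ i) (r i m) = m) (a : A i) :
    IsSynchronous₂ fun u v => ∃ m, reducedRep (r i) m = u ∧ reducedRep (r i) (m * ψ i a) = v := by
  have hinj {w : List (A i)} (hw : w ∈ L i) : r i (val (ψ i) w) = w :=
    hL.unique _ (hrL _) _ hw (hr _)
  have hnt : (L i ⊓ ({r i 1} : Language (A i))ᶜ).IsRegular :=
    hL.regular.inf (isRegular_singleton _).compl
  have key (w s : List (A i)) : (∃ m, reducedRep (r i) m = w ∧ r i m = s) ↔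
      (w ∈ L i ⊓ ({r i 1} : Language (A i))ᶜ ∧ w = s) ∨
        (w ∈ ({[]} : Language (A i)) ∧ s ∈ ({r i 1} : Language (A i))) := by
    constructor
    · rintro ⟨m, rfl, rfl⟩
      by_cases hm : m = 1
      · right
        simp only [reducedRep, hm, if_true]
        exact ⟨rfl, rfl⟩
      · left
        simp only [reducedRep, hm, if_false, and_true]
        refine ⟨hrL m, fun h => hm ?_⟩
        have h : r i m = r i 1 := h
        rw [← hr m, h, hr]
    · rintro (⟨⟨hw, hw1⟩, rfl⟩ | ⟨hw, hs⟩)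
      · refine ⟨val (ψ i) w, ?_, hinj hw⟩
        rw [reducedRep, if_neg, hinj hw]
        intro h
        apply hw1
        rw [← hinj hw, h]
        rfl
      · obtain rfl : w = [] := hw
        obtain rfl : s = r i 1 := hs
        exact ⟨1, by simp [reducedRep], rfl⟩
  have h₁ : IsSynchronous₂ fun w s => ∃ m, reducedRep (r i) m = w ∧ r i m = s :=
    (((IsSynchronous₂.left hnt).and .eq).or
      ((IsSynchronous₂.left (isRegular_singleton _)).and
        (.right (isRegular_singleton _)))).congr key
  have h₂ : IsSynchronous₂ fun s w => ∃ m, reducedRep (r i) m = w ∧ r i m = s :=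
    (((IsSynchronous₂.right hnt).and .eq).or
      ((IsSynchronous₂.right (isRegular_singleton _)).and
        (.left (isRegular_singleton _)))).congr fun s w => by rw [key, eq_comm (a := w)]
  refine ((h₁.comp (hL.mul a)).comp h₂).congr fun u v => ?_
  constructor
  · rintro ⟨m, rfl, rfl⟩
    exact ⟨r i (m * ψ i a), ⟨r i m, ⟨m, rfl, rfl⟩, hrL _, hrL _, by rw [hr, hr]⟩, _, rfl, rfl⟩
  · rintro ⟨_, ⟨_, ⟨m, rfl, rfl⟩, -, -, h⟩, m', rfl, rfl⟩
    rw [hr, hr] at h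
    exact ⟨m, rfl, by rw [h]⟩

end FreeProductStructure

section Bool

open scoped Computability

variable {M : Bool → Type*} [∀ i, Monoid (M i)] {A : Bool → Type*}
  {ψ : ∀ i, A i → M i} {r : ∀ i, M i → List (A i)} {L : ∀ i, Language (A i)}

theorem isRegular_syllableLanguage {i : Bool} (hL : IsCrossSection (ψ i) (L i))
    (hrL : ∀ m, r i m ∈ L i) (hr : ∀ m, val (ψ i) (r i m) = m) :
    (syllableLanguage r i).IsRegular := by
  refine ((hL.regular.inf (isRegular_singleton (r i 1)).compl).map (letter i)).congr fun w => ?_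
  constructor
  · rintro ⟨m, hm, rfl⟩
    refine ⟨r i m, ⟨hrL m, fun h => hm ?_⟩, rfl⟩
    have h : r i m = r i 1 := h
    rw [← hr m, h, hr]
  · rintro ⟨w, ⟨hw, hw1⟩, rfl⟩
    have hw' : r i (val (ψ i) w) = w := hL.unique _ (hrL _) _ hw (hr _)
    refine ⟨val (ψ i) w, fun h => hw1 ?_, by rw [hw']⟩
    rw [← hw', h]
    rfl

theorem isCrossSection_encode (hL : ∀ i, IsCrossSection (ψ i) (L i))
    (hrL : ∀ i m, r i m ∈ L i) (hr : ∀ i m, val (ψ i) (r i m) = m) :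
    IsCrossSection (letterValue ψ) {w | ∃ l, IsReduced l ∧ none :: encode r l = w} := by
  have hval (l : List (Σ i, M i)) :
      val (letterValue ψ) (none :: encode r l) = syllableProd l := by
    rw [val_cons, val_letterValue_encode hr, letterValue, one_mul]
  have hsyl (i : Bool) : (syllableLanguage r i).IsRegular :=
    isRegular_syllableLanguage (hL i) (hrL i) (hr i)
  have hone (i : Bool) : (1 + syllableLanguage r i).IsRegular :=
    Language.IsRegular.add (isRegular_singleton []) (hsyl i)
  have hP (i : Bool) : Language.IsRegular ({w | ∃ l ∈ reducedNotEnding M i,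
      none :: encode r l = w} : Language (Option (Σ i, A i))) := by
    refine ((isRegular_singleton [none]).mul
      ((hone !i).mul ((hsyl i).mul (hsyl !i)).kstar)).congr fun w => ⟨?_, ?_⟩
    · rintro ⟨l, hl, rfl⟩
      exact ⟨_, rfl, _, (mem_kstar_pair_iff r (by cases i <;> decide) (by cases i <;> decide) _).2
        ⟨l, hl, rfl⟩, rfl⟩
    · rintro ⟨_, rfl, w, hw, rfl⟩
      obtain ⟨l, hl, rfl⟩ :=
        (mem_kstar_pair_iff r (by cases i <;> decide) (by cases i <;> decide) _).1 hw
      exact ⟨l, hl, rfl⟩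
  have hreg : Language.IsRegular ({w | ∃ l, IsReduced l ∧ none :: encode r l = w} :
      Language (Option (Σ i, A i))) := by
    refine ((hP true).mul (hone true)).congr fun w => ⟨?_, ?_⟩
    · rintro ⟨l, hl, rfl⟩
      obtain ⟨l, hl', m, rfl⟩ := exists_append_syllable true hl
      refine ⟨_, ⟨l, hl', rfl⟩, encode r (syllable true m), ?_, by rw [encode_append]; rfl⟩
      by_cases hm : m = 1
      · left
        simp only [syllable, hm, if_true]
        rfl
      · right
        refine ⟨m, hm, ?_⟩
        rw [encode_syllable, reducedRep, if_neg hm]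
    · rintro ⟨_, ⟨l, hl, rfl⟩, w, hw | ⟨m, hm, rfl⟩, rfl⟩
      · obtain rfl : w = [] := hw
        exact ⟨l, hl.1, (List.append_nil _).symm⟩
      · refine ⟨_, isReduced_append_syllable hl m, ?_⟩
        rw [encode_append, encode_syllable, reducedRep, if_neg hm]
        rfl
  have huniq : ∀ u ∈ {w | ∃ l, IsReduced l ∧ none :: encode r l = w},
      ∀ v ∈ {w | ∃ l, IsReduced l ∧ none :: encode r l = w},
      val (letterValue ψ) u = val (letterValue ψ) v → u = v := by
    rintro _ ⟨l, hl, rfl⟩ _ ⟨l', hl', rfl⟩ h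
    rw [hval, hval] at h
    rw [hl.eq hl' h]
  refine ⟨?_, hreg, fun g => ?_, huniq, ?_⟩
  · rintro _ ⟨l, -, rfl⟩
    exact List.cons_ne_nil _ _
  · obtain ⟨l, hl, rfl⟩ := exists_isReduced g
    exact ⟨_, ⟨l, hl, rfl⟩, hval l⟩
  · rintro (_ | ⟨i, a⟩)
    · refine ((IsSynchronous₂.left hreg).and .eq).congr fun u v => ⟨?_, ?_⟩
      · rintro ⟨hu, hv, h⟩
        exact ⟨hu, huniq u hu v hv (by simpa [letterValue] using h)⟩
      · rintro ⟨hu, rfl⟩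
        exact ⟨hu, hu, mul_one _⟩
    · refine (((isSynchronous₂_reducedRep (hL i) (hrL i) (hr i) a).map (letter i)).prepend
        (hP i)).congr fun u v => ⟨?_, ?_⟩
      · rintro ⟨⟨l, hl, rfl⟩, ⟨l', hl', rfl⟩, h⟩
        obtain ⟨l, hli, m, rfl⟩ := exists_append_syllable i hl
        obtain rfl := (isReduced_append_syllable hli (m * ψ i a)).eq hl' (by
          rw [hval, hval] at h
          rw [← h, syllableProd_append, syllableProd_append, syllableProd_syllable,
            syllableProd_syllable, map_mul, mul_assoc, letterValue])
        refine ⟨_, ⟨l, hli, rfl⟩, _, _, ⟨_, _, ⟨m, rfl, rfl⟩, rfl, rfl⟩, ?_, ?_⟩ <;>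
        · rw [encode_append, encode_syllable]
          rfl
      · rintro ⟨_, ⟨l, hl, rfl⟩, _, _, ⟨_, _, ⟨m, rfl, rfl⟩, rfl, rfl⟩, rfl, rfl⟩
        simp only [← encode_syllable, List.cons_append, ← encode_append]
        refine ⟨⟨_, isReduced_append_syllable hl _, rfl⟩,
          ⟨_, isReduced_append_syllable hl _, rfl⟩, ?_⟩
        rw [hval, hval, syllableProd_append, syllableProd_append, syllableProd_syllable,
          syllableProd_syllable, map_mul, mul_assoc, letterValue]

theorem isAutomaticSemigroup_coprodI (h : ∀ i, IsAutomaticSemigroup (M i)) :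
    IsAutomaticSemigroup (CoprodI M) := by
  simp only [isAutomaticSemigroup_iff] at h ⊢
  choose A hA ψ L hL using h
  choose r hrL hr using fun i => (hL i).onto
  exact ⟨_, inferInstance, _, _, isCrossSection_encode hL hrL hr⟩

end Bool

section Coprod

universe u v

/-- A pair of monoids as a family in a common universe. -/
abbrev pairFamily (M : Type u) (N : Type v) (b : Bool) : Type (max u v) :=
  Bool.rec (ULift.{v} M) (ULift.{u} N) b

instance (M : Type u) (N : Type v) [Monoid M] [Monoid N] : ∀ b, Monoid (pairFamily M N b)
  | false => inferInstanceAs (Monoid (ULift M))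
  | true => inferInstanceAs (Monoid (ULift N))

/-- The binary free product is the free product of a family of two monoids. -/
def coprodEquivCoprodI (M : Type u) (N : Type v) [Monoid M] [Monoid N] :
    Monoid.Coprod M N ≃* CoprodI (pairFamily M N) :=
  MonoidHom.toMulEquiv
    (Coprod.lift ((of (M := pairFamily M N) (i := false)).comp MulEquiv.ulift.symm.toMonoidHom)
      ((of (M := pairFamily M N) (i := true)).comp MulEquiv.ulift.symm.toMonoidHom))
    (CoprodI.lift fun
      | false => Coprod.inl.comp MulEquiv.ulift.toMonoidHom
      | true => Coprod.inr.comp MulEquiv.ulift.toMonoidHom)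
    (by
      ext x
      · simp [MulEquiv.ulift]
      · simp [MulEquiv.ulift])
    (by
      ext b x
      cases b
      · simp [MulEquiv.ulift]
      · simp [MulEquiv.ulift])

end Coprod

end AutoSg

open AutoSg in
/-- The monoid free product `M₁ ∗ M₂` is automatic iff both `M₁` and `M₂` are. -/
theorem monoid_coprod_automatic_iff (M₁ M₂ : Type*) [Monoid M₁] [Monoid M₂] :
    IsAutomaticSemigroup (Monoid.Coprod M₁ M₂) ↔
      IsAutomaticSemigroup M₁ ∧ IsAutomaticSemigroup M₂ := by
  constructor
  · intro h
    have h := isAutomaticSemigroup_of_coprodI (h.of_mulEquiv (coprodEquivCoprodI M₁ M₂))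
    exact ⟨(h false).of_mulEquiv MulEquiv.ulift, (h true).of_mulEquiv MulEquiv.ulift⟩
  · rintro ⟨h₁, h₂⟩
    refine (isAutomaticSemigroup_coprodI fun b => ?_).of_mulEquiv (coprodEquivCoprodI M₁ M₂).symm
    cases b
    exacts [h₁.of_mulEquiv MulEquiv.ulift.symm, h₂.of_mulEquiv MulEquiv.ulift.symm]
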